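/- arXiv:1504.06516 — 2 statements merged into one kernel-verified Lean document; each statement's English description precedes it below -/
import Mathlib

section
/- Let C₁, C₂, C₃ be real 2×2 matrices each of rank one, and for ε ∈ {−1,+1}³ write X_ε = ε₁C₁ + ε₂C₂ + ε₃C₃. Let α, β ≥ 0 satisfy α + β = 1/4, α ≤ 3β and β ≤ 3α. Then every rank-one convex function f : M₂(ℝ) → ℝ satisfies f(0) ≤ α·(f(X₊₊₊) + f(X₊₋₋) + f(X₋₊₋) + f(X₋₋₊)) + β·(f(X₋₋₋) + f(X₊₊₋) + f(X₊₋₊) + f(X₋₊₊)). (Equivalently: every symmetric probability measure on the vertices of the rank-one cube with barycenter 0 and ratio α/β ∈ [1/3, 3] is a laminate.) -/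
open Matrix

/-- Directional convexity along the cone `p v w + q w u + r u v = 0`. -/
def RC3 (p q r : ℝ) (F : ℝ → ℝ → ℝ → ℝ) : Prop :=
  ∀ x y z x₁ y₁ z₁ x₂ y₂ z₂ s t : ℝ, 0 ≤ s → 0 ≤ t → s + t = 1 →
    x = s * x₁ + t * x₂ → y = s * y₁ + t * y₂ → z = s * z₁ + t * z₂ →
    p * ((y₁ - y₂) * (z₁ - z₂)) + q * ((z₁ - z₂) * (x₁ - x₂)) + r * ((x₁ - x₂) * (y₁ - y₂)) = 0 →
    F x y z ≤ s * F x₁ y₁ z₁ + t * F x₂ y₂ z₂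

noncomputable def mU (F : ℝ → ℝ → ℝ → ℝ) : ℝ :=
  (F 1 1 1 + F 1 (-1) (-1) + F (-1) 1 (-1) + F (-1) (-1) 1
    + F (-1) (-1) (-1) + F 1 1 (-1) + F 1 (-1) 1 + F (-1) 1 1) / 8 - F 0 0 0

noncomputable def mT (F : ℝ → ℝ → ℝ → ℝ) : ℝ :=
  (F 1 1 1 + F 1 (-1) (-1) + F (-1) 1 (-1) + F (-1) (-1) 1
    - F (-1) (-1) (-1) - F 1 1 (-1) - F 1 (-1) 1 - F (-1) 1 1) / 8

noncomputable def mA (F : ℝ → ℝ → ℝ → ℝ) : ℝ :=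
  (F 1 1 1 + F 1 (-1) (-1) - F (-1) 1 (-1) - F (-1) (-1) 1
    + F (-1) (-1) (-1) - F 1 1 (-1) - F 1 (-1) 1 + F (-1) 1 1) / 8

noncomputable def mB (F : ℝ → ℝ → ℝ → ℝ) : ℝ :=
  (F 1 1 1 - F 1 (-1) (-1) + F (-1) 1 (-1) - F (-1) (-1) 1
    + F (-1) (-1) (-1) - F 1 1 (-1) + F 1 (-1) 1 - F (-1) 1 1) / 8

noncomputable def mC (F : ℝ → ℝ → ℝ → ℝ) : ℝ :=
  (F 1 1 1 - F 1 (-1) (-1) - F (-1) 1 (-1) + F (-1) (-1) 1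
    + F (-1) (-1) (-1) + F 1 1 (-1) - F 1 (-1) 1 - F (-1) 1 1) / 8

lemma RC3.swap12 {p q r : ℝ} {F : ℝ → ℝ → ℝ → ℝ} (h : RC3 p q r F) :
    RC3 q p r (fun x y z => F y x z) := by
  intro x y z x₁ y₁ z₁ x₂ y₂ z₂ s t hs ht hst hx hy hz hc
  exact h _ _ _ _ _ _ _ _ _ s t hs ht hst hy hx hz (by linear_combination hc)

lemma RC3.swap23 {p q r : ℝ} {F : ℝ → ℝ → ℝ → ℝ} (h : RC3 p q r F) :
    RC3 p r q (fun x y z => F x z y) := by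
  intro x y z x₁ y₁ z₁ x₂ y₂ z₂ s t hs ht hst hx hy hz hc
  exact h _ _ _ _ _ _ _ _ _ s t hs ht hst hx hz hy (by linear_combination hc)

lemma RC3.flip12 {p q r : ℝ} {F : ℝ → ℝ → ℝ → ℝ} (h : RC3 p q r F) :
    RC3 (-p) (-q) r (fun x y z => F (-x) (-y) z) := by
  intro x y z x₁ y₁ z₁ x₂ y₂ z₂ s t hs ht hst hx hy hz hc
  exact h _ _ _ _ _ _ _ _ _ s t hs ht hst (by rw [hx]; ring) (by rw [hy]; ring) hz
    (by linear_combination hc)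

lemma RC3.negc {p q r : ℝ} {F : ℝ → ℝ → ℝ → ℝ} (h : RC3 p q r F) :
    RC3 (-p) (-q) (-r) F := by
  intro x y z x₁ y₁ z₁ x₂ y₂ z₂ s t hs ht hst hx hy hz hc
  exact h _ _ _ _ _ _ _ _ _ s t hs ht hst hx hy hz (by linear_combination -hc)

lemma RC3.stepX {p q r : ℝ} {F : ℝ → ℝ → ℝ → ℝ} (h : RC3 p q r F) (x y z : ℝ)
    (h1 : -1 ≤ x) (h2 : x ≤ 1) :
    F x y z ≤ (1 + x) / 2 * F 1 y z + (1 - x) / 2 * F (-1) y z :=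
  h _ _ _ _ _ _ _ _ _ _ _ (by linarith) (by linarith) (by ring) (by ring) (by ring) (by ring)
    (by ring)

lemma RC3.stepY {p q r : ℝ} {F : ℝ → ℝ → ℝ → ℝ} (h : RC3 p q r F) (x y z : ℝ)
    (h1 : -1 ≤ y) (h2 : y ≤ 1) :
    F x y z ≤ (1 + y) / 2 * F x 1 z + (1 - y) / 2 * F x (-1) z :=
  h _ _ _ _ _ _ _ _ _ _ _ (by linarith) (by linarith) (by ring) (by ring) (by ring) (by ring)
    (by ring)

lemma RC3.stepZ {p q r : ℝ} {F : ℝ → ℝ → ℝ → ℝ} (h : RC3 p q r F) (x y z : ℝ)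
    (h1 : -1 ≤ z) (h2 : z ≤ 1) :
    F x y z ≤ (1 + z) / 2 * F x y 1 + (1 - z) / 2 * F x y (-1) :=
  h _ _ _ _ _ _ _ _ _ _ _ (by linarith) (by linarith) (by ring) (by ring) (by ring) (by ring)
    (by ring)

lemma RC3.base {p q r : ℝ} {F : ℝ → ℝ → ℝ → ℝ} (h : RC3 p q r F) : 0 ≤ mU F := by
  have h0 := h.stepX 0 0 0 (by norm_num) (by norm_num)
  have h1 := h.stepY 1 0 0 (by norm_num) (by norm_num)
  have h2 := h.stepY (-1) 0 0 (by norm_num) (by norm_num)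
  have h3 := h.stepZ 1 1 0 (by norm_num) (by norm_num)
  have h4 := h.stepZ 1 (-1) 0 (by norm_num) (by norm_num)
  have h5 := h.stepZ (-1) 1 0 (by norm_num) (by norm_num)
  have h6 := h.stepZ (-1) (-1) 0 (by norm_num) (by norm_num)
  unfold mU
  linarith

/-- One vanishing coefficient. -/
lemma RC3.degen {q r : ℝ} {F : ℝ → ℝ → ℝ → ℝ} (h : RC3 0 q r F) : 0 ≤ 2 * mU F + mT F := by
  have hb := h.base
  have h0 := h.stepX 0 0 0 (by norm_num) (by norm_num)
  have h1 := h 1 0 0 1 1 1 1 (-1) (-1) (1/2) (1/2) (by norm_num) (by norm_num) (by norm_num)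
    (by norm_num) (by norm_num) (by norm_num) (by norm_num)
  have h2 := h (-1) 0 0 (-1) 1 (-1) (-1) (-1) 1 (1/2) (1/2) (by norm_num) (by norm_num)
    (by norm_num) (by norm_num) (by norm_num) (by norm_num) (by norm_num)
  unfold mU mT at *
  linarith

lemma RC3.Za {p q r : ℝ} {F : ℝ → ℝ → ℝ → ℝ} (h : RC3 p q r F) (hp : 0 < p) (hq : 0 < q)
    (hr : 0 < r) (hpq : p ≤ q + r) :
    0 ≤ (q + r) * mU F + (q + r) * mA F + (-p) * mB F + (-p) * mC F := by
  have hs : 0 < q + r := by linarith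
  obtain ⟨s, hsd⟩ : ∃ s, s = p / (q + r) := ⟨_, rfl⟩
  have e : s * (q + r) = p := by rw [hsd]; field_simp
  have s0 : 0 ≤ s := by rw [hsd]; positivity
  have s1 : s ≤ 1 := by rw [hsd, div_le_one hs]; exact hpq
  have h0 := h 0 0 0 (-s) 1 1 s (-1) (-1) (1/2) (1/2) (by norm_num) (by norm_num) (by norm_num)
    (by ring) (by norm_num) (by norm_num) (by linear_combination (-4) * e)
  have h1 := h.stepX (-s) 1 1 (by linarith) (by linarith)
  have h2 := h.stepX s (-1) (-1) (by linarith) (by linarith)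
  have hh : 0 ≤ mU F + mA F - s * mB F - s * mC F := by
    unfold mU mA mB mC
    linarith
  have := mul_nonneg hs.le hh
  rw [← e]
  linarith

lemma RC3.Zb {p q r : ℝ} {F : ℝ → ℝ → ℝ → ℝ} (h : RC3 p q r F) (hp : 0 < p) (hq : 0 < q)
    (hr : 0 < r) (hpq : q + r ≤ p) :
    0 ≤ p ^ 2 * mU F + (q + r) ^ 2 * mA F + (-(p * (q + r))) * mB F
      + (-(p * (q + r))) * mC F := by
  have hs : 0 < q + r := by linarith
  obtain ⟨s, hsd⟩ : ∃ s, s = (q + r) / p := ⟨_, rfl⟩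
  have e : s * p = q + r := by rw [hsd]; field_simp
  have s0 : 0 ≤ s := by rw [hsd]; positivity
  have s1 : s ≤ 1 := by rw [hsd, div_le_one hp]; exact hpq
  have h0 := h 0 0 0 (-1) s s 1 (-s) (-s) (1/2) (1/2) (by norm_num) (by norm_num) (by norm_num)
    (by norm_num) (by ring) (by ring) (by linear_combination (4 * s) * e)
  have h1 := h.stepY (-1) s s (by linarith) (by linarith)
  have h2 := h.stepZ (-1) 1 s (by linarith) (by linarith)
  have h3 := h.stepZ (-1) (-1) s (by linarith) (by linarith)
  have h4 := h.stepY 1 (-s) (-s) (by linarith) (by linarith)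
  have h5 := h.stepZ 1 1 (-s) (by linarith) (by linarith)
  have h6 := h.stepZ 1 (-1) (-s) (by linarith) (by linarith)
  have h2' := mul_le_mul_of_nonneg_left h2 (by linarith : 0 ≤ (1 + s) / 2)
  have h3' := mul_le_mul_of_nonneg_left h3 (by linarith : 0 ≤ (1 - s) / 2)
  have h5' := mul_le_mul_of_nonneg_left h5 (by linarith : 0 ≤ (1 - s) / 2)
  have h6' := mul_le_mul_of_nonneg_left h6 (by linarith : 0 ≤ (1 + s) / 2)
  have hh : 0 ≤ mU F + s ^ 2 * mA F - s * mB F - s * mC F := by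
    unfold mU mA mB mC
    linarith
  have := mul_nonneg (sq_nonneg p) hh
  rw [← e]
  linarith

/-- The main building block. -/
lemma RC3.V {b c a : ℝ} {F : ℝ → ℝ → ℝ → ℝ} (h : RC3 b c a F) (hb : 0 < b) (hc : 0 < c)
    (ha : 0 < a) (hX : 0 ≤ a + c - b) (hY : 0 ≤ a + b - c) :
    0 ≤ ((a + c) * ((a + c - b) * (a + b - c) + a * c)) * mU F
      + (c * ((b - c) * (a + c))) * mA F
      + (c * (a ^ 2 + a * c - a * b - b ^ 2 + b * c)) * mB F
      + (-(c * ((b - c) ^ 2 + a * c))) * mC F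
      + ((a + c) * ((a + c - b) * (a + b - c))) * mT F := by
  obtain ⟨X, hXd⟩ : ∃ X, X = a + c - b := ⟨_, rfl⟩
  obtain ⟨Y, hYd⟩ : ∃ Y, Y = a + b - c := ⟨_, rfl⟩
  rw [← hXd] at hX
  rw [← hYd] at hY
  have hE : 0 < X + c := by linarith
  have hT : 0 < a + 2 * c := by linarith
  have hM : 0 < c * (a + 2 * c) + a * (X + c) := by positivity
  have hac : 0 < a + c := by linarith
  have hab : 0 < a + b := by linarith
  have hK : 0 < X * Y + a * c := by positivity
  obtain ⟨M, hMd⟩ : ∃ M, M = c * (a + 2 * c) + a * (X + c) := ⟨_, rfl⟩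
  rw [← hMd] at hM
  have hb' : b = a + c - X := by linarith
  have hY' : Y = 2 * a - X := by linarith
  have hX2 : X ≤ a + c := by linarith
  have hMX : M = a * X + 2 * c * (a + c) := by rw [hMd]; ring
  -- first split
  have h1 := h 0 0 0 0 (Y / (a + b)) 0 0 (-(X / (X + c))) 0
    (X * (a + b) / (2 * (X * Y + a * c))) (Y * (X + c) / (2 * (X * Y + a * c)))
    (by positivity) (by positivity)
    (by rw [← add_div, div_eq_one_iff_eq (by positivity)]; rw [hXd, hYd]; ring)
    (by ring) (by field_simp; ring) (by ring) (by ring)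
  have h2 := h 0 (Y / (a + b)) 0 1 (1 - 2 * (c / (a + b))) 1 (-1) 1 (-1) (1/2) (1/2)
    (by norm_num) (by norm_num) (by norm_num) (by norm_num)
    (by field_simp; rw [hYd]; ring) (by norm_num) (by field_simp; ring)
  have h3 := h 0 (-(X / (X + c))) 0 (-1) (-1) (a / (a + 2 * c))
    (X * (a + 2 * c) / M) (-(a * X / M)) (-(a * X / M))
    (X * (a + 2 * c) / (2 * (X + c) * (a + c))) (M / (2 * (X + c) * (a + c)))
    (by positivity) (by positivity)
    (by rw [← add_div, div_eq_one_iff_eq (by positivity)]; rw [hMd]; ring)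
    (by field_simp; ring) (by field_simp; ring) (by field_simp; ring)
    (by field_simp; rw [hMd, hb']; ring)
  have h4 := h (X * (a + 2 * c) / M) (-(a * X / M)) (-(a * X / M))
    (1 - 2 * (b / (a + c))) 1 1 1 (-1) (-1) (c * (a + c) / M) ((M + a * X) / (2 * M))
    (by positivity) (by positivity)
    (by field_simp; rw [hMX]; ring)
    (by field_simp; rw [hMX, hb']; ring) (by field_simp; rw [hMX]; ring)
    (by field_simp; rw [hMX]; ring)
    (by field_simp; ring)
  have h5 := h.stepY 1 (1 - 2 * (c / (a + b))) 1
    (by have : c / (a + b) ≤ 1 := by rw [div_le_one hab]; linarith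
        linarith)
    (by have : 0 ≤ c / (a + b) := by positivity
        linarith)
  have h6 := h.stepZ (-1) (-1) (a / (a + 2 * c))
    (by have : 0 ≤ a / (a + 2 * c) := by positivity
        linarith)
    (by rw [div_le_one hT]; linarith)
  have h7 := h.stepX (1 - 2 * (b / (a + c))) 1 1
    (by have : b / (a + c) ≤ 1 := by rw [div_le_one hac]; linarith
        linarith)
    (by have : 0 ≤ b / (a + c) := by positivity
        linarith)
  generalize F 0 (Y / (a + b)) 0 = f2 at *
  generalize F 0 (-(X / (X + c))) 0 = f3 at *
  generalize F (X * (a + 2 * c) / M) (-(a * X / M)) (-(a * X / M)) = f4 at *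
  generalize F 1 (1 - 2 * (c / (a + b))) 1 = f5 at *
  generalize F (-1) (-1) (a / (a + 2 * c)) = f6 at *
  generalize F (1 - 2 * (b / (a + c))) 1 1 = f7 at *
  have g1 := mul_le_mul_of_nonneg_left h1 (by positivity : 0 ≤ (a + c) * (2 * (X * Y + a * c)))
  have g2 := mul_le_mul_of_nonneg_left h2 (by positivity : 0 ≤ (a + c) * X * (a + b))
  have g3 := mul_le_mul_of_nonneg_left h3 (by positivity : 0 ≤ (a + c) * Y * (X + c))
  have g4 := mul_le_mul_of_nonneg_left h4 (by positivity : 0 ≤ 1 / 2 * Y * M)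
  have g5 := mul_le_mul_of_nonneg_left h5 (by positivity : 0 ≤ 1 / 2 * (a + c) * X * (a + b))
  have g6 := mul_le_mul_of_nonneg_left h6 (by positivity : 0 ≤ 1 / 2 * Y * X * (a + 2 * c))
  have g7 := mul_le_mul_of_nonneg_left h7 (by positivity : 0 ≤ 1 / 2 * Y * c * (a + c))
  have r1 : (a + c) * (2 * (X * Y + a * c)) * (X * (a + b) / (2 * (X * Y + a * c)) * f2 +
      Y * (X + c) / (2 * (X * Y + a * c)) * f3)
      = (a + c) * X * (a + b) * f2 + (a + c) * Y * (X + c) * f3 := by field_simp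
  have r3 : (a + c) * Y * (X + c) * (X * (a + 2 * c) / (2 * (X + c) * (a + c)) * f6 +
      M / (2 * (X + c) * (a + c)) * f4)
      = 1 / 2 * Y * X * (a + 2 * c) * f6 + 1 / 2 * Y * M * f4 := by field_simp
  have r4 : 1 / 2 * Y * M * (c * (a + c) / M * f7 + (M + a * X) / (2 * M) * F 1 (-1) (-1))
      = 1 / 2 * Y * c * (a + c) * f7 + 1 / 4 * Y * (M + a * X) * F 1 (-1) (-1) := by
    field_simp; ring
  have r5 : 1 / 2 * (a + c) * X * (a + b) * ((1 + (1 - 2 * (c / (a + b)))) / 2 * F 1 1 1 +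
      (1 - (1 - 2 * (c / (a + b)))) / 2 * F 1 (-1) 1)
      = 1 / 2 * (a + c) * X * (Y * F 1 1 1 + c * F 1 (-1) 1) := by
    field_simp; rw [hYd]; ring
  have r6 : 1 / 2 * Y * X * (a + 2 * c) * ((1 + a / (a + 2 * c)) / 2 * F (-1) (-1) 1 +
      (1 - a / (a + 2 * c)) / 2 * F (-1) (-1) (-1))
      = 1 / 2 * Y * X * ((a + c) * F (-1) (-1) 1 + c * F (-1) (-1) (-1)) := by
    field_simp; ring
  have r7 : 1 / 2 * Y * c * (a + c) * ((1 + (1 - 2 * (b / (a + c)))) / 2 * F 1 1 1 +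
      (1 - (1 - 2 * (b / (a + c)))) / 2 * F (-1) 1 1)
      = 1 / 2 * Y * c * (X * F 1 1 1 + b * F (-1) 1 1) := by
    field_simp; rw [hb']; ring
  rw [r1] at g1
  rw [r3] at g3
  rw [r4] at g4
  rw [r5] at g5
  rw [r6] at g6
  rw [r7] at g7
  have key : (a + c) * (2 * (X * Y + a * c)) * F 0 0 0 ≤
      1 / 2 * (a + c) * X * (Y * F 1 1 1 + c * F 1 (-1) 1 + (a + b) * F (-1) 1 (-1))
      + 1 / 2 * Y * X * ((a + c) * F (-1) (-1) 1 + c * F (-1) (-1) (-1))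
      + 1 / 2 * Y * (c * X * F 1 1 1 + b * c * F (-1) 1 1)
      + 1 / 4 * Y * (M + a * X) * F 1 (-1) (-1) := by
    linarith
  rw [hMX, hXd, hYd] at key
  unfold mU mA mB mC mT
  linarith

lemma comb3 {u A B C T W₁ a₁ b₁ c₁ g₁ W₂ a₂ b₂ c₂ g₂ W₃ a₃ b₃ c₃ g₃ : ℝ} (hu : 0 ≤ u)
    (h₁ : 0 ≤ W₁ * u + a₁ * A + b₁ * B + c₁ * C + g₁ * T)
    (h₂ : 0 ≤ W₂ * u + a₂ * A + b₂ * B + c₂ * C + g₂ * T)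
    (h₃ : 0 ≤ W₃ * u + a₃ * A + b₃ * B + c₃ * C + g₃ * T)
    (m₁ m₂ m₃ : ℝ) (hm₁ : 0 ≤ m₁) (hm₂ : 0 ≤ m₂) (hm₃ : 0 ≤ m₃)
    (ea : m₁ * a₁ + m₂ * a₂ + m₃ * a₃ = 0)
    (eb : m₁ * b₁ + m₂ * b₂ + m₃ * b₃ = 0)
    (ec : m₁ * c₁ + m₂ * c₂ + m₃ * c₃ = 0)
    (hW₁ : 0 < W₁) (hW₂ : 0 < W₂) (hW₃ : 0 < W₃) (hm : 0 < m₁ + m₂ + m₃)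
    (ho : 0 ≤ 2 * (m₁ * g₁ + m₂ * g₂ + m₃ * g₃) - (m₁ * W₁ + m₂ * W₂ + m₃ * W₃)) :
    0 ≤ 2 * u + T := by
  have hpos : 0 < m₁ * g₁ + m₂ * g₂ + m₃ * g₃ := by
    have hs : 0 < m₁ * W₁ + m₂ * W₂ + m₃ * W₃ := by
      by_contra hcon
      have n1 := mul_nonneg hm₁ hW₁.le
      have n2 := mul_nonneg hm₂ hW₂.le
      have n3 := mul_nonneg hm₃ hW₃.le
      have z1 : m₁ = 0 := (mul_eq_zero.1 (by linarith : m₁ * W₁ = 0)).resolve_right hW₁.ne'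
      have z2 : m₂ = 0 := (mul_eq_zero.1 (by linarith : m₂ * W₂ = 0)).resolve_right hW₂.ne'
      have z3 : m₃ = 0 := (mul_eq_zero.1 (by linarith : m₃ * W₃ = 0)).resolve_right hW₃.ne'
      linarith
    linarith
  have e : (m₁ * g₁ + m₂ * g₂ + m₃ * g₃) * (2 * u + T)
      = m₁ * (W₁ * u + a₁ * A + b₁ * B + c₁ * C + g₁ * T)
      + m₂ * (W₂ * u + a₂ * A + b₂ * B + c₂ * C + g₂ * T)
      + m₃ * (W₃ * u + a₃ * A + b₃ * B + c₃ * C + g₃ * T)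
      + (2 * (m₁ * g₁ + m₂ * g₂ + m₃ * g₃) - (m₁ * W₁ + m₂ * W₂ + m₃ * W₃)) * u := by
    linear_combination (-A) * ea - B * eb - C * ec
  have : 0 ≤ (m₁ * g₁ + m₂ * g₂ + m₃ * g₃) * (2 * u + T) := by
    rw [e]; positivity
  exact nonneg_of_mul_nonneg_right this hpos

lemma swap12_eqs (F : ℝ → ℝ → ℝ → ℝ) :
    mU (fun x y z => F y x z) = mU F ∧ mT (fun x y z => F y x z) = mT F ∧
    mA (fun x y z => F y x z) = mB F ∧ mB (fun x y z => F y x z) = mA F ∧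
    mC (fun x y z => F y x z) = mC F := by
  unfold mU mT mA mB mC
  refine ⟨?_, ?_, ?_, ?_, ?_⟩ <;> ring

lemma swap23_eqs (F : ℝ → ℝ → ℝ → ℝ) :
    mU (fun x y z => F x z y) = mU F ∧ mT (fun x y z => F x z y) = mT F ∧
    mA (fun x y z => F x z y) = mA F ∧ mB (fun x y z => F x z y) = mC F ∧
    mC (fun x y z => F x z y) = mB F := by
  unfold mU mT mA mB mC
  refine ⟨?_, ?_, ?_, ?_, ?_⟩ <;> ring

/-- `(x,y,z) ↦ F z x y`. -/
lemma cyc1_eqs (F : ℝ → ℝ → ℝ → ℝ) :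
    mU (fun x y z => F z x y) = mU F ∧ mT (fun x y z => F z x y) = mT F ∧
    mA (fun x y z => F z x y) = mB F ∧ mB (fun x y z => F z x y) = mC F ∧
    mC (fun x y z => F z x y) = mA F := by
  unfold mU mT mA mB mC
  refine ⟨?_, ?_, ?_, ?_, ?_⟩ <;> ring

lemma cyc2_eqs (F : ℝ → ℝ → ℝ → ℝ) :
    mU (fun x y z => F y z x) = mU F ∧ mT (fun x y z => F y z x) = mT F ∧
    mA (fun x y z => F y z x) = mC F ∧ mB (fun x y z => F y z x) = mA F ∧
    mC (fun x y z => F y z x) = mB F := by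
  unfold mU mT mA mB mC
  refine ⟨?_, ?_, ?_, ?_, ?_⟩ <;> ring

set_option maxHeartbeats 4000000 in
lemma RC3.sorted {p q r : ℝ} {F : ℝ → ℝ → ℝ → ℝ} (h : RC3 p q r F) (hp : 0 < p)
    (hpq : p ≤ q) (hqr : q ≤ r) : 0 ≤ 2 * mU F + mT F := by
  have hq : 0 < q := by linarith
  have hr : 0 < r := by linarith
  have hu := h.base
  have rc12 : RC3 q p r (fun x y z => F y x z) := h.swap12
  have rc32 : RC3 q r p (fun x y z => F z x y) := h.swap12.swap23
  have rc13 : RC3 r p q (fun x y z => F y z x) := h.swap23.swap12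
  obtain ⟨s1, s2, s3, s4, s5⟩ := swap12_eqs F
  obtain ⟨c1, c2, c3, c4, c5⟩ := cyc1_eqs F
  obtain ⟨d1, d2, d3, d4, d5⟩ := cyc2_eqs F
  have V12 := rc12.V hq hp hr (by linarith) (by linarith)
  rw [s1, s2, s3, s4, s5] at V12
  have V12' : 0 ≤ ((r+p)*((r+p-q)*(r+q-p)+r*p))*mU F + (p*(r^2+r*p-r*q-q^2+q*p))*mA F
      + (p*((q-p)*(r+p)))*mB F + (-(p*((q-p)^2+r*p)))*mC F
      + ((r+p)*((r+p-q)*(r+q-p)))*mT F := by linarith [V12]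
  have W12 : 0 < (r+p)*((r+p-q)*(r+q-p)+r*p) := by
    have : 0 ≤ r + p - q := by linarith
    have : 0 ≤ r + q - p := by linarith
    positivity
  have Z1 := h.Za hp hq hr (by linarith)
  have Z1' : 0 ≤ (q+r)*mU F + (q+r)*mA F + (-p)*mB F + (-p)*mC F + 0*mT F := by linarith [Z1]
  have W1 : 0 < q + r := by linarith
  rcases le_total r (p + q) with htri | htri
  · have V32 := rc32.V hq hr hp (by linarith) (by linarith)
    rw [c1, c2, c3, c4, c5] at V32
    have V32' : 0 ≤ ((p+r)*((p+r-q)*(p+q-r)+p*r))*mU F + (-(r*((q-r)^2+p*r)))*mA F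
        + (r*((q-r)*(p+r)))*mB F + (r*(p^2+p*r-p*q-q^2+q*r))*mC F
        + ((p+r)*((p+r-q)*(p+q-r)))*mT F := by linarith [V32]
    have W32 : 0 < (p+r)*((p+r-q)*(p+q-r)+p*r) := by
      have : 0 ≤ p + r - q := by linarith
      have : 0 ≤ p + q - r := by linarith
      positivity
    have h32 : 0 < (p + q - r) * (p + r - q) + p * r := by
      have : 0 ≤ (p + q - r) * (p + r - q) := mul_nonneg (by linarith) (by linarith)
      have := mul_pos hp hr
      linarith
    have X1 : 0 < q + r - p := by linarith
    have X2 : 0 < p + r - q := by linarith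
    rcases le_total (2 * q) (p + r) with hA | hB
    · have V21 := h.V hp hq hr (by linarith) (by linarith)
      obtain ⟨x, hx⟩ : ∃ x, x = q - p := ⟨_, rfl⟩
      obtain ⟨y, hy⟩ : ∃ y, y = p + r - 2 * q := ⟨_, rfl⟩
      obtain ⟨z, hz⟩ : ∃ z, z = p + q - r := ⟨_, rfl⟩
      have x0 : 0 ≤ x := by linarith
      have y0 : 0 ≤ y := by linarith
      have z0 : 0 ≤ z := by linarith
      have ep : p = x + y + z := by linarith
      have eq : q = 2 * x + y + z := by linarith
      have er : r = 3 * x + 2 * y + z := by linarith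
      have k1 : 0 ≤ ((-1)*p^3 + (3)*p^2*q + (-3)*p^2*r + (-2)*p*q^2 + (5)*p*q*r + (-1)*p*r^2 + (-1)*q^2*r + (1)*r^3) := by
        rw [ep, eq, er]; ring_nf; positivity
      have k2 : 0 ≤ ((1)*p^3 + (-3)*p^2*q + (3)*p^2*r + (2)*p*q^2 + (-6)*p*q*r + (3)*p*r^2 + (2)*q^2*r + (-3)*q*r^2 + (1)*r^3) := by
        rw [ep, eq, er]; ring_nf; positivity
      have k3 : 0 ≤ ((-1)*p^2*r + (2)*p*q*r + (-1)*q^2*r + (1)*r^3) := by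
        rw [ep, eq, er]; ring_nf; positivity
      have k1' : 0 < ((-1)*p^3 + (3)*p^2*q + (-3)*p^2*r + (-2)*p*q^2 + (5)*p*q*r + (-1)*p*r^2 + (-1)*q^2*r + (1)*r^3) := by
        have e : ((-1)*p^3 + (3)*p^2*q + (-3)*p^2*r + (-2)*p*q^2 + (5)*p*q*r + (-1)*p*r^2 + (-1)*q^2*r + (1)*r^3) = ((q - p) * (r - q) * (q + r) * (p + r)
          + (r ^ 2 + (q - p) * r + p * (q - p)) * ((r - q) ^ 2 + p * r)) / r := by
          field_simp; ring
        rw [e]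
        have : 0 ≤ q - p := by linarith
        have : 0 ≤ r - q := by linarith
        positivity
      have W21 : 0 < (r+q)*((r+q-p)*(r+p-q)+r*q) := by
        have : 0 ≤ r + q - p := by linarith
        have : 0 ≤ r + p - q := by linarith
        positivity
      refine comb3 hu V12' V21 V32'
        (((-1)*p^3 + (3)*p^2*q + (-3)*p^2*r + (-2)*p*q^2 + (5)*p*q*r + (-1)*p*r^2 + (-1)*q^2*r + (1)*r^3) * (q * r)) (((1)*p^3 + (-3)*p^2*q + (3)*p^2*r + (2)*p*q^2 + (-6)*p*q*r + (3)*p*r^2 + (2)*q^2*r + (-3)*q*r^2 + (1)*r^3) * (p * r)) (((-1)*p^2*r + (2)*p*q*r + (-1)*q^2*r + (1)*r^3) * (p * q))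
        (by positivity) (by positivity) (by positivity) (by ring) (by ring) (by ring) W12 W21 W32
        (by positivity) ?_
      rw [ep, eq, er]; ring_nf; positivity
    · have V13 := rc13.V hr hp hq (by linarith) (by linarith)
      rw [d1, d2, d3, d4, d5] at V13
      have V13' : 0 ≤ ((q+p)*((q+p-r)*(q+r-p)+q*p))*mU F + (p*(q^2+q*p-q*r-r^2+r*p))*mA F
          + (-(p*((r-p)^2+q*p)))*mB F + (p*((r-p)*(q+p)))*mC F
          + ((q+p)*((q+p-r)*(q+r-p)))*mT F := by linarith [V13]
      have W13 : 0 < (q+p)*((q+p-r)*(q+r-p)+q*p) := by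
        have : 0 ≤ q + p - r := by linarith
        have : 0 ≤ q + r - p := by linarith
        positivity
      obtain ⟨x, hx⟩ : ∃ x, x = 2 * q - p - r := ⟨_, rfl⟩
      obtain ⟨y, hy⟩ : ∃ y, y = r - q := ⟨_, rfl⟩
      obtain ⟨z, hz⟩ : ∃ z, z = p + q - r := ⟨_, rfl⟩
      have x0 : 0 ≤ x := by linarith
      have y0 : 0 ≤ y := by linarith
      have z0 : 0 ≤ z := by linarith
      have ep : p = y + z := by linarith
      have eq : q = x + 2 * y + z := by linarith
      have er : r = x + 3 * y + z := by linarith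
      rcases lt_or_ge ((1)*p^2*q + (1)*p^2*r + (-5)*p*q*r + (-1)*q^3 + (2)*q^2*r + (2)*q*r^2 + (-1)*r^3) 0 with hk | hk
      · have a1 : 0 ≤ ((1)*p^3 + (-1)*p^2*q + (-3)*p*q^2 + (5)*p*q*r + (-1)*p*r^2 + (-1)*q^3 + (3)*q^2*r + (-2)*q*r^2) := by
          rw [ep, eq, er]; ring_nf; positivity
        have a2 : 0 ≤ ((-1)*p^3 + (3)*p^2*q + (-3)*p^2*r + (-2)*p*q^2 + (6)*p*q*r + (-3)*p*r^2 + (-2)*q^2*r + (3)*q*r^2 + (-1)*r^3) := by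
          rw [ep, eq, er]; ring_nf; positivity
        have nk : 0 < ((-1)*p^2*q + (-1)*p^2*r + (5)*p*q*r + (1)*q^3 + (-2)*q^2*r + (-2)*q*r^2 + (1)*r^3) := by linarith
        refine comb3 hu V12' V13' V32'
          (((1)*p^3 + (-1)*p^2*q + (-3)*p*q^2 + (5)*p*q*r + (-1)*p*r^2 + (-1)*q^3 + (3)*q^2*r + (-2)*q*r^2) * r) (((-1)*p^3 + (3)*p^2*q + (-3)*p^2*r + (-2)*p*q^2 + (6)*p*q*r + (-3)*p*r^2 + (-2)*q^2*r + (3)*q*r^2 + (-1)*r^3) * r) (((-1)*p^2*q + (-1)*p^2*r + (5)*p*q*r + (1)*q^3 + (-2)*q^2*r + (-2)*q*r^2 + (1)*r^3) * p)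
          (by positivity) (by positivity) (by positivity) (by ring) (by ring) (by ring)
          W12 W13 W32 (by positivity) ?_
        rw [ep, eq, er]; ring_nf; positivity
      · have f0 : 0 ≤ r - p := by linarith
        have e0 : 0 ≤ q - p := by linarith
        have a1 : 0 < ((-1)*p*r + (1)*q*r + (1)*r^2) := by
          have : 0 < (r-p)^2 + p*q + (r-p)*(p+q) := by positivity
          linarith
        have a2 : 0 < ((-1)*p*q + (1)*q^2 + (1)*q*r) := by
          have : 0 < (q-p)^2 + p*r + (q-p)*(p+r) := by positivity
          linarith
        refine comb3 hu V12' V13' Z1'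
          (((-1)*p*r + (1)*q*r + (1)*r^2)) (((-1)*p*q + (1)*q^2 + (1)*q*r)) (((1)*p^2*q + (1)*p^2*r + (-5)*p*q*r + (-1)*q^3 + (2)*q^2*r + (2)*q*r^2 + (-1)*r^3) * p)
          (by positivity) (by positivity) (by positivity) (by ring) (by ring) (by ring)
          W12 W13 W1 (by positivity) ?_
        rw [ep, eq, er]; ring_nf; positivity
  · have Z3 := rc13.Zb hr hp hq (by linarith)
    rw [d1, d3, d4, d5] at Z3
    have Z3' : 0 ≤ r^2*mU F + (-(r*(p+q)))*mA F + (-(r*(p+q)))*mB F + (p+q)^2*mC F + 0*mT F := by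
      linarith [Z3]
    have W3 : 0 < r^2 := by positivity
    have Z2 := rc12.Za hq hp hr (by linarith)
    rw [s1, s3, s4, s5] at Z2
    have Z2' : 0 ≤ (p+r)*mU F + (-q)*mA F + (p+r)*mB F + (-q)*mC F + 0*mT F := by
      linarith [Z2]
    have W2 : 0 < p + r := by linarith
    obtain ⟨x, hx⟩ : ∃ x, x = p := ⟨_, rfl⟩
    obtain ⟨y, hy⟩ : ∃ y, y = q - p := ⟨_, rfl⟩
    obtain ⟨z, hz⟩ : ∃ z, z = r - p - q := ⟨_, rfl⟩
    have x0 : 0 < x := by linarith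
    have y0 : 0 ≤ y := by linarith
    have z0 : 0 ≤ z := by linarith
    have ep : p = x := by linarith
    have eq : q = x + y := by linarith
    have er : r = 2 * x + y + z := by linarith
    rcases le_total 0 ((1)*p^2 + (2)*p*r + (-1)*q^2 + (-2)*q*r + (1)*r^2) with hk | hk
    · have a1 : 0 < ((1)*p + (1)*q + (1)*r) := by
        rw [ep, eq, er]; ring_nf; positivity
      have a3 : 0 ≤ ((1)*p^2 + (-1)*p*q + (2)*p*r + (-1)*q*r + (1)*r^2) := by
        rw [ep, eq, er]; ring_nf; positivity
      refine comb3 hu V12' Z2' Z3'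
        (((1)*p + (1)*q + (1)*r) * (p+q)) (((1)*p^2 + (2)*p*r + (-1)*q^2 + (-2)*q*r + (1)*r^2) * (p * (p + q))) (((1)*p^2 + (-1)*p*q + (2)*p*r + (-1)*q*r + (1)*r^2) * p)
        (by positivity) (by positivity) (by positivity) (by ring) (by ring) (by ring)
        W12 W2 W3 (by positivity) ?_
      rw [ep, eq, er]; ring_nf; positivity
    · have a1 : 0 < ((1)*p + (1)*q + (1)*r) := by
        rw [ep, eq, er]; ring_nf; positivity
      have a2 : 0 ≤ ((-1)*p^2 + (-2)*p*r + (1)*q^2 + (2)*q*r + (-1)*r^2) := by linarith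
      have a3 : 0 ≤ ((-1)*p*q + (1)*q^2 + (1)*q*r) := by
        rw [ep, eq, er]; ring_nf; positivity
      refine comb3 hu V12' Z1' Z3'
        (((1)*p + (1)*q + (1)*r) * (p+q)) (((-1)*p^2 + (-2)*p*r + (1)*q^2 + (2)*q*r + (-1)*r^2) * (p * (p + q))) (((-1)*p*q + (1)*q^2 + (1)*q*r) * p)
        (by positivity) (by positivity) (by positivity) (by ring) (by ring) (by ring)
        W12 W1 W3 (by positivity) ?_
      rw [ep, eq, er]; ring_nf; positivity

lemma RC3.posall {p q r : ℝ} {F : ℝ → ℝ → ℝ → ℝ} (h : RC3 p q r F) (hp : 0 < p)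
    (hq : 0 < q) (hr : 0 < r) : 0 ≤ 2 * mU F + mT F := by
  -- first: q ≤ r case, then swap
  have key : ∀ {p q r : ℝ} {F : ℝ → ℝ → ℝ → ℝ}, RC3 p q r F → 0 < p → 0 < q → 0 < r → q ≤ r →
      0 ≤ 2 * mU F + mT F := by
    intro p q r F h hp hq hr hqr
    rcases le_total p q with h1 | h1
    · exact h.sorted hp h1 hqr
    · obtain ⟨s1, s2, -⟩ := swap12_eqs F
      rcases le_total p r with h2 | h2
      · have := h.swap12.sorted hq h1 h2
        rwa [s1, s2] at this
      · have := h.swap12.swap23.sorted hq hqr h2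
        obtain ⟨c1, c2, -⟩ := cyc1_eqs F
        rwa [c1, c2] at this
  rcases le_total q r with h1 | h1
  · exact key h hp hq hr h1
  · obtain ⟨s1, s2, -⟩ := swap23_eqs F
    have := key h.swap23 hp hr hq h1
    rwa [s1, s2] at this

lemma flip12_eqs (F : ℝ → ℝ → ℝ → ℝ) :
    mU (fun x y z => F (-x) (-y) z) = mU F ∧ mT (fun x y z => F (-x) (-y) z) = mT F := by
  unfold mU mT
  simp only [neg_neg, neg_zero]
  constructor <;> ring

lemma RC3.qpos {p q r : ℝ} {F : ℝ → ℝ → ℝ → ℝ} (h : RC3 p q r F) (hr : r ≠ 0) (hpq : 0 < p * q) :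
    0 ≤ 2 * mU F + mT F := by
  have key : ∀ {p q r : ℝ} {F : ℝ → ℝ → ℝ → ℝ}, RC3 p q r F → 0 < p * q → 0 < r →
      0 ≤ 2 * mU F + mT F := by
    intro p q r F h hpq hr
    rcases pos_and_pos_or_neg_and_neg_of_mul_pos hpq with ⟨a, b⟩ | ⟨a, b⟩
    · exact h.posall a b hr
    · have := h.flip12.posall (by linarith) (by linarith) hr
      obtain ⟨s1, s2⟩ := flip12_eqs F
      rwa [s1, s2] at this
  rcases lt_or_gt_of_ne hr with h1 | h1
  · exact key h.negc (by linarith [neg_mul_neg p q]) (by linarith)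
  · exact key h hpq h1

lemma RC3.all {p q r : ℝ} {F : ℝ → ℝ → ℝ → ℝ} (h : RC3 p q r F) : 0 ≤ 2 * mU F + mT F := by
  by_cases hp : p = 0
  · subst hp; exact h.degen
  by_cases hq : q = 0
  · subst hq
    have := h.swap12.degen
    obtain ⟨s1, s2, -⟩ := swap12_eqs F
    rwa [s1, s2] at this
  by_cases hr : r = 0
  · subst hr
    have := h.swap23.swap12.degen
    obtain ⟨s1, s2, -⟩ := cyc2_eqs F
    rwa [s1, s2] at this
  by_cases h1 : 0 < p * q
  · exact h.qpos hr h1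
  by_cases h2 : 0 < p * r
  · have := h.swap23.qpos hq h2
    obtain ⟨s1, s2, -⟩ := swap23_eqs F
    rwa [s1, s2] at this
  have h3 : 0 < q * r := by
    have a1 : p * q < 0 := lt_of_le_of_ne (not_lt.1 h1) (mul_ne_zero hp hq)
    have a2 : p * r < 0 := lt_of_le_of_ne (not_lt.1 h2) (mul_ne_zero hp hr)
    have a3 := mul_pos_of_neg_of_neg a1 a2
    have a4 : 0 < p ^ 2 := by positivity
    exact pos_of_mul_pos_right (by linarith [show p * q * (p * r) = p ^ 2 * (q * r) by ring] :
      0 < p ^ 2 * (q * r)) a4.le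
  have := h.swap12.swap23.qpos hp (by linarith)
  obtain ⟨c1, c2, -⟩ := cyc1_eqs F
  rwa [c1, c2] at this

lemma RC3.all' {p q r : ℝ} {F : ℝ → ℝ → ℝ → ℝ} (h : RC3 p q r F) : 0 ≤ 2 * mU F - mT F := by
  have h' : RC3 p q r (fun x y z => F (-x) (-y) (-z)) := by
    intro x y z x₁ y₁ z₁ x₂ y₂ z₂ s t hs ht hst hx hy hz hc
    exact h _ _ _ _ _ _ _ _ _ s t hs ht hst (by rw [hx]; ring) (by rw [hy]; ring)
      (by rw [hz]; ring) (by linear_combination hc)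
  have := h'.all
  unfold mU mT at *
  simp only [neg_neg, neg_zero] at this
  linarith

lemma det_zero_of_rank_one {C : Matrix (Fin 2) (Fin 2) ℝ} (h : C.rank = 1) :
    C 0 0 * C 1 1 - C 0 1 * C 1 0 = 0 := by
  rw [← Matrix.det_fin_two]
  by_contra hd
  have : IsUnit C := (Matrix.isUnit_iff_isUnit_det C).2 (isUnit_iff_ne_zero.2 hd)
  have := Matrix.rank_of_isUnit C this
  simp [h] at this

lemma rank_le_one_of_det {C : Matrix (Fin 2) (Fin 2) ℝ}
    (h : C 0 0 * C 1 1 - C 0 1 * C 1 0 = 0) : C.rank ≤ 1 := by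
  have hv : ∃ u v : Fin 2 → ℝ, C = Matrix.vecMulVec u v := by
    by_cases h0 : C 0 0 = 0
    · by_cases h1 : C 0 1 = 0
      · refine ⟨![0, 1], ![C 1 0, C 1 1], ?_⟩
        ext i j; fin_cases i <;> fin_cases j <;> simp [Matrix.vecMulVec, h0, h1]
      · have h2 : C 1 0 = 0 := by
          have : C 0 1 * C 1 0 = 0 := by rw [h0] at h; linarith
          exact (mul_eq_zero.1 this).resolve_left h1
        refine ⟨![C 0 1, C 1 1], ![0, 1], ?_⟩
        ext i j; fin_cases i <;> fin_cases j <;> simp [Matrix.vecMulVec, h0, h2]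
    · refine ⟨![1, C 1 0 / C 0 0], ![C 0 0, C 0 1], ?_⟩
      ext i j; fin_cases i <;> fin_cases j <;> simp [Matrix.vecMulVec, h0]
      field_simp; linarith
  obtain ⟨u, v, rfl⟩ := hv
  exact Matrix.rank_vecMulVec_le u v

lemma rc3_of_rankOneConvex
    (C₁ C₂ C₃ : Matrix (Fin 2) (Fin 2) ℝ)
    (hC₁ : C₁.rank = 1) (hC₂ : C₂.rank = 1) (hC₃ : C₃.rank = 1)
    (f : Matrix (Fin 2) (Fin 2) ℝ → ℝ)
    (hf : ∀ A B : Matrix (Fin 2) (Fin 2) ℝ, B.rank ≤ 1 →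
      ConvexOn ℝ Set.univ (fun t : ℝ => f (A + t • B))) :
    RC3 (C₂ 0 0 * C₃ 1 1 + C₃ 0 0 * C₂ 1 1 - C₂ 0 1 * C₃ 1 0 - C₃ 0 1 * C₂ 1 0)
      (C₃ 0 0 * C₁ 1 1 + C₁ 0 0 * C₃ 1 1 - C₃ 0 1 * C₁ 1 0 - C₁ 0 1 * C₃ 1 0)
      (C₁ 0 0 * C₂ 1 1 + C₂ 0 0 * C₁ 1 1 - C₁ 0 1 * C₂ 1 0 - C₂ 0 1 * C₁ 1 0)
      (fun x y z => f (x • C₁ + y • C₂ + z • C₃)) := by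
  have d1 := det_zero_of_rank_one hC₁
  have d2 := det_zero_of_rank_one hC₂
  have d3 := det_zero_of_rank_one hC₃
  intro x y z x₁ y₁ z₁ x₂ y₂ z₂ s t hs ht hst hx hy hz hc
  have hB : ((x₁ - x₂) • C₁ + (y₁ - y₂) • C₂ + (z₁ - z₂) • C₃).rank ≤ 1 := by
    apply rank_le_one_of_det
    simp only [Matrix.add_apply, Matrix.smul_apply, smul_eq_mul]
    linear_combination hc + (x₁ - x₂) ^ 2 * d1 + (y₁ - y₂) ^ 2 * d2 + (z₁ - z₂) ^ 2 * d3
  have := (hf (x₂ • C₁ + y₂ • C₂ + z₂ • C₃) _ hB).2 (Set.mem_univ 1) (Set.mem_univ 0) hs ht hst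
  simp only [smul_eq_mul, mul_one, mul_zero, add_zero, one_smul, zero_smul] at this
  have ht' : t = 1 - s := by linarith
  have e1 : x₂ • C₁ + y₂ • C₂ + z₂ • C₃ + s • ((x₁ - x₂) • C₁ + (y₁ - y₂) • C₂ + (z₁ - z₂) • C₃)
      = x • C₁ + y • C₂ + z • C₃ := by
    rw [hx, hy, hz, ht']; module
  have e2 : x₂ • C₁ + y₂ • C₂ + z₂ • C₃ + ((x₁ - x₂) • C₁ + (y₁ - y₂) • C₂ + (z₁ - z₂) • C₃)
      = x₁ • C₁ + y₁ • C₂ + z₁ • C₃ := by module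
  rw [e1, e2] at this
  exact this

/-- Every symmetric measure on the vertices of a rank-one cube with
barycenter `0` and ratio `α/β ∈ [1/3, 3]` is a laminate. -/
theorem symmetric_measure_is_laminate
    (C₁ C₂ C₃ : Matrix (Fin 2) (Fin 2) ℝ)
    (hC₁ : C₁.rank = 1) (hC₂ : C₂.rank = 1) (hC₃ : C₃.rank = 1)
    (α β : ℝ) (hα : 0 ≤ α) (hβ : 0 ≤ β) (hsum : α + β = 1/4)
    (hαβ : α ≤ 3 * β) (hβα : β ≤ 3 * α)
    (f : Matrix (Fin 2) (Fin 2) ℝ → ℝ)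
    (hf : ∀ A B : Matrix (Fin 2) (Fin 2) ℝ, B.rank ≤ 1 →
      ConvexOn ℝ Set.univ (fun t : ℝ => f (A + t • B))) :
    f 0 ≤ α * (f (C₁ + C₂ + C₃) + f (C₁ - C₂ - C₃) + f (-C₁ + C₂ - C₃)
                 + f (-C₁ - C₂ + C₃))
        + β * (f (-C₁ - C₂ - C₃) + f (C₁ + C₂ - C₃) + f (C₁ - C₂ + C₃)
                 + f (-C₁ + C₂ + C₃)) := by
  have h := rc3_of_rankOneConvex C₁ C₂ C₃ hC₁ hC₂ hC₃ f hf
  have p1 := h.all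
  have p2 := h.all'
  unfold mU mT at p1 p2
  simp only [one_smul, neg_smul, zero_smul, add_zero, ← sub_eq_add_neg] at p1 p2
  have hb : β = 1/4 - α := by linarith
  subst hb
  have w1 : 0 ≤ 8 * α - 1/2 := by linarith
  have w2 : 0 ≤ 3/2 - 8 * α := by linarith
  have q1 := mul_nonneg w1 p1
  have q2 := mul_nonneg w2 p2
  linarith
end

section
/- Let C₁, C₂, C₃ be real 2×2 matrices each of rank one, X_ε = ε₁C₁ + ε₂C₂ + ε₃C₃, and suppose a = det(C₁+C₂), b = det(C₁+C₃), c = det(C₂+C₃) satisfy a, b, c > 0 together with the triangle inequalities a < b+c, b < a+c, c < a+b. Then there exist α, β > 0 with α + β = 1/4 and β/α = (a+b+c)·(1/a + 1/b + 1/c) − 6 ≥ 3, such that every rank-one convex function f : M₂(ℝ) → ℝ satisfies f(0) ≤ α·(f(X₊₊₊) + f(X₊₋₋) + f(X₋₊₋) + f(X₋₋₊)) + β·(f(X₋₋₋) + f(X₊₊₋) + f(X₊₋₊) + f(X₋₊₊)). -/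
open Matrix


/-- Convexity along the cone `a xy + b xz + c yz = 0`, in mass-weighted form. -/
def ConeConv (a b c : ℝ) (g : ℝ → ℝ → ℝ → ℝ) : Prop :=
  ∀ x y z x1 y1 z1 x2 y2 z2 m1 m2 : ℝ, 0 ≤ m1 → 0 ≤ m2 →
    a * (x1 - x2) * (y1 - y2) + b * (x1 - x2) * (z1 - z2) + c * (y1 - y2) * (z1 - z2) = 0 →
    (m1 + m2) * x = m1 * x1 + m2 * x2 →
    (m1 + m2) * y = m1 * y1 + m2 * y2 →
    (m1 + m2) * z = m1 * z1 + m2 * z2 →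
    (m1 + m2) * g x y z ≤ m1 * g x1 y1 z1 + m2 * g x2 y2 z2

set_option maxHeartbeats 2000000 in
theorem type_three_aux (a b c : ℝ) (g : ℝ → ℝ → ℝ → ℝ) (H : ConeConv a b c g)
    (ha : 0 < a) (hb : 0 < b) (hc : 0 < c) (h3 : a < b + c) (h1 : c < a + b)
    (hbc : b ≤ c) (z : ℝ) (hz : z * (b + c) = a) :
    4 * g 0 0 0 ≤ (1 - z) * (g (-1) 1 1 + g 1 (-1) 1) + (1 + z ^ 2) * g 1 1 (-1)
      + (1 - z ^ 2) * g (-1) (-1) (-1) + z * (1 + z) * g (-1) (-1) 1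
      + z * (1 - z) * g 1 1 1 := by
  have hz0 : 0 < z := by
    by_contra h
    nlinarith
  have hz1 : z < 1 := by
    by_contra h
    nlinarith
  obtain ⟨v, hv⟩ : ∃ v : ℝ, v = (1 + z) / 2 := ⟨_, rfl⟩
  have hv0 : 0 < v := by linarith
  have hv1 : v < 1 := by linarith
  obtain ⟨S, hS⟩ : ∃ S : ℝ, S = a + b + c := ⟨_, rfl⟩
  have hS0 : 0 < S := by linarith
  have hvS : 2 * v * (b + c) = S := by rw [hv, hS]; linarith
  obtain ⟨M1, hM1⟩ : ∃ M : ℝ, M = (v * (a + b) + c) / S := ⟨_, rfl⟩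
  have hM1' : M1 * S = v * (a + b) + c := by rw [hM1]; field_simp
  have hM1p : 0 < M1 := by rw [hM1]; positivity
  obtain ⟨M2, hM2⟩ : ∃ M : ℝ, M = (1 + v * z) / 2 := ⟨_, rfl⟩
  have hM2p : 0 < M2 := by rw [hM2]; positivity
  have hM2' : M2 * S = v * (a * v + b + c) := by
    rw [hM2, ← hvS, ← hz]; ring
  -- exit masses
  have hd1 : (1 - M1) * S = (1 - v) * (a + b) := by rw [sub_mul, hM1', hS]; ring
  have hd1p : 0 ≤ 1 - M1 := by
    have : 0 ≤ (1 - M1) * S := by rw [hd1]; apply mul_nonneg <;> linarith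
    exact nonneg_of_mul_nonneg_left this hS0
  have hd2 : (M1 - M2) * S = (1 - v) * (a * v + c) := by
    rw [sub_mul, hM1', hM2']; ring
  have hd2p : 0 ≤ M1 - M2 := by
    have : 0 ≤ (M1 - M2) * S := by
      rw [hd2]; apply mul_nonneg; linarith
      positivity
    exact nonneg_of_mul_nonneg_left this hS0
  obtain ⟨E1, hE1⟩ : ∃ E : ℝ, E = S / (a + b) := ⟨_, rfl⟩
  have hE1' : E1 * (a + b) = S := by rw [hE1]; field_simp
  obtain ⟨E2, hE2⟩ : ∃ E : ℝ, E = S / (a * v + c) := ⟨_, rfl⟩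
  have hq : 0 < a * v + c := by positivity
  have hE2' : E2 * (a * v + c) = S := by rw [hE2]; field_simp
  have hm1 : (1 - M1) * E1 = 1 - v := by
    have : ((1 - M1) * E1 - (1 - v)) * S = 0 := by
      linear_combination E1 * hd1 + (1 - v) * hE1'
    rcases mul_eq_zero.1 this with h | h <;> linarith
  have hm2 : (M1 - M2) * E2 = 1 - v := by
    have : ((M1 - M2) * E2 - (1 - v)) * S = 0 := by
      linear_combination E2 * hd2 + (1 - v) * hE2'
    rcases mul_eq_zero.1 this with h | h <;> linarith
  have hm1p : 0 ≤ (1 - M1) - (1 - v) / 2 := by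
    have hE : E1 ≤ 2 := by rw [hE1, div_le_iff₀ (by linarith)]; linarith
    nlinarith
  have hm2p : 0 ≤ (M1 - M2) - (1 - v) / 2 := by
    have hE : E2 ≤ 2 := by
      rw [hE2, div_le_iff₀ hq, hv, hS]
      nlinarith [mul_pos ha hz0]
    nlinarith
  -- step 1
  have s1 := H 0 0 0 (1 - E1) 1 1 (1 - v / M1) (1 - 1 / M1) (1 - 1 / M1) (1 - M1) M1 hd1p
    hM1p.le (by
      field_simp
      linear_combination -hM1' - M1 * hE1') (by
      field_simp
      linear_combination hm1) (by field_simp; ring) (by field_simp; ring)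
  have s2 := H (1 - v / M1) (1 - 1 / M1) (1 - 1 / M1) 1 (1 - E2) 1
    (1 - v / M2) (1 - v / M2) (1 - 1 / M2) (M1 - M2) M2 hd2p hM2p.le (by
      field_simp
      linear_combination -hM2' - M2 * hE2') (by
      field_simp
      ring) (by
      field_simp
      linear_combination M1 * hm2) (by field_simp; ring)
  have s3 := H (1 - v / M2) (1 - v / M2) (1 - 1 / M2) 1 1 (-1) (-1) (-1) (2 * z - 1)
    (M2 - v / 2) (v / 2) (by nlinarith) (by linarith) (by
      linear_combination -4 * hz) (by
      field_simp
      ring) (by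
      field_simp
      ring) (by
      field_simp
      linear_combination 4 * M2 * hM2)
  have s4 := H (1 - E1) 1 1 (-1) 1 1 1 1 1 ((1 - v) / 2) ((1 - M1) - (1 - v) / 2)
    (by linarith) hm1p (by ring) (by linear_combination -hm1) (by ring) (by ring)
  have s5 := H 1 (1 - E2) 1 1 (-1) 1 1 1 1 ((1 - v) / 2) ((M1 - M2) - (1 - v) / 2)
    (by linarith) hm2p (by ring) (by ring) (by linear_combination -hm2) (by ring)
  have s6 := H (-1) (-1) (2 * z - 1) (-1) (-1) (-1) (-1) (-1) 1 (v / 2 * (1 - z)) (v / 2 * z)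
    (by apply mul_nonneg <;> linarith) (by positivity) (by ring) (by ring) (by ring) (by ring)
  clear hm1p hm2p hE1 hE2 hm1 hm2 hE1' hE2' hd1 hd2 hM1 hM1' hM2'
  generalize g 0 0 0 = g0 at *
  generalize g (1 - E1) 1 1 = g1 at *
  generalize g (1 - v / M1) (1 - 1 / M1) (1 - 1 / M1) = g2 at *
  generalize g 1 (1 - E2) 1 = g3 at *
  generalize g (1 - v / M2) (1 - v / M2) (1 - 1 / M2) = g4 at *
  generalize g (-1) (-1) (2 * z - 1) = g5 at *
  generalize g (-1) 1 1 = k1 at *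
  generalize g 1 (-1) 1 = k2 at *
  generalize g 1 1 (-1) = k3 at *
  generalize g (-1) (-1) (-1) = k4 at *
  generalize g (-1) (-1) 1 = k5 at *
  generalize g 1 1 1 = k6 at *
  have s : g0 ≤ (1 - v) / 2 * (k1 + k2) + (M2 - v / 2) * k3 + v / 2 * (1 - z) * k4
      + v / 2 * z * k5 + (v - M2) * k6 := by linarith
  subst hM2
  subst hv
  linarith

theorem type_three (a b c : ℝ) (g : ℝ → ℝ → ℝ → ℝ) (H : ConeConv a b c g)
    (ha : 0 < a) (hb : 0 < b) (hc : 0 < c) (h3 : a < b + c) (h1 : c < a + b)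
    (h2 : b < a + c) :
    4 * g 0 0 0 ≤ (1 - a / (b + c)) * (g (-1) 1 1 + g 1 (-1) 1) + (1 + (a / (b + c)) ^ 2) * g 1 1 (-1)
      + (1 - (a / (b + c)) ^ 2) * g (-1) (-1) (-1)
      + (a / (b + c)) * (1 + a / (b + c)) * g (-1) (-1) 1
      + (a / (b + c)) * (1 - a / (b + c)) * g 1 1 1 := by
  have hz : a / (b + c) * (b + c) = a := by field_simp
  rcases le_total b c with h | h
  · exact type_three_aux a b c g H ha hb hc h3 h1 h _ hz
  · have := type_three_aux a c b (fun x y z => g y x z) (by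
      intro x y z x1 y1 z1 x2 y2 z2 m1 m2 p1 p2 q e1 e2 e3
      exact H y x z y1 x1 z1 y2 x2 z2 m1 m2 p1 p2 (by linarith) e2 e1 e3) ha hc hb
      (by linarith) h2 h (a / (b + c)) (by rw [add_comm c b]; exact hz)
    linarith

theorem cone_of_rank (C₁ C₂ C₃ : Matrix (Fin 2) (Fin 2) ℝ)
    (h₁ : C₁.det = 0) (h₂ : C₂.det = 0) (h₃ : C₃.det = 0)
    (hr : ∀ B : Matrix (Fin 2) (Fin 2) ℝ, B.det = 0 → B.rank ≤ 1)
    (f : Matrix (Fin 2) (Fin 2) ℝ → ℝ)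
    (hf : ∀ A B : Matrix (Fin 2) (Fin 2) ℝ, B.rank ≤ 1 →
          ConvexOn ℝ Set.univ (fun t : ℝ => f (A + t • B))) :
    ConeConv (C₁ + C₂).det (C₁ + C₃).det (C₂ + C₃).det
      (fun x y z => f (x • C₁ + y • C₂ + z • C₃)) := by
  intro x y z x1 y1 z1 x2 y2 z2 m1 m2 p1 p2 q e1 e2 e3
  simp only
  rcases (add_nonneg p1 p2).eq_or_lt with h | h
  · have : m1 = 0 := by linarith
    have h' : m2 = 0 := by linarith
    simp [this, h']
  · have hB := hf (x2 • C₁ + y2 • C₂ + z2 • C₃)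
      ((x1 - x2) • C₁ + (y1 - y2) • C₂ + (z1 - z2) • C₃) (hr _ (by
        simp only [Matrix.det_fin_two, Matrix.add_apply, Matrix.smul_apply, smul_eq_mul]
          at h₁ h₂ h₃ q ⊢
        linear_combination q + ((x1 - x2) ^ 2 - (x1 - x2) * (y1 - y2) - (x1 - x2) * (z1 - z2)) * h₁
         + ((y1 - y2) ^ 2 - (x1 - x2) * (y1 - y2) - (y1 - y2) * (z1 - z2)) * h₂
         + ((z1 - z2) ^ 2 - (x1 - x2) * (z1 - z2) - (y1 - y2) * (z1 - z2)) * h₃))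
    have := hB.2 (Set.mem_univ (1:ℝ)) (Set.mem_univ (0:ℝ)) (show 0 ≤ m1 / (m1 + m2) by positivity)
      (show 0 ≤ m2 / (m1 + m2) by positivity) (by field_simp)
    have hx : x = x2 + m1 / (m1 + m2) * (x1 - x2) := by
      field_simp; linear_combination e1
    have hy : y = y2 + m1 / (m1 + m2) * (y1 - y2) := by
      field_simp; linear_combination e2
    have hz : z = z2 + m1 / (m1 + m2) * (z1 - z2) := by
      field_simp; linear_combination e3
    have k0 : x2 • C₁ + y2 • C₂ + z2 • C₃ +
      (m1 / (m1 + m2)) • ((x1 - x2) • C₁ + (y1 - y2) • C₂ + (z1 - z2) • C₃)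
       = x • C₁ + y • C₂ + z • C₃ := by
      rw [hx, hy, hz]; module
    have k1 : x2 • C₁ + y2 • C₂ + z2 • C₃ +
      ((x1 - x2) • C₁ + (y1 - y2) • C₂ + (z1 - z2) • C₃)
       = x1 • C₁ + y1 • C₂ + z1 • C₃ := by module
    simp only [smul_eq_mul, mul_one, mul_zero, add_zero, one_smul, zero_smul, k0, k1] at this
    calc _ ≤ (m1 + m2) * _ := mul_le_mul_of_nonneg_left this h.le
      _ = _ := by field_simp

theorem det_zero_of_rank (C : Matrix (Fin 2) (Fin 2) ℝ) (h : C.rank = 1) : C.det = 0 := by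
  by_contra hd
  have := Matrix.rank_of_isUnit C ((Matrix.isUnit_iff_isUnit_det C).2 (isUnit_iff_ne_zero.2 hd))
  simp [h] at this

theorem rank_of_det_zero (B : Matrix (Fin 2) (Fin 2) ℝ) (h : B.det = 0) : B.rank ≤ 1 := by
  by_contra hd
  have h1 : B.rank ≤ 2 := by simpa using B.rank_le_card_width
  have h2 : B.rank = 2 := by omega
  have : LinearIndependent ℝ B.col := by
    rw [linearIndependent_iff_card_eq_finrank_span, Set.finrank, ← Matrix.rank_eq_finrank_span_cols, h2]
    simp
  have := (Matrix.linearIndependent_cols_iff_isUnit.1 this)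
  rw [Matrix.isUnit_iff_isUnit_det, h] at this
  simp at this

theorem type_three_poly (a b c : ℝ) (g : ℝ → ℝ → ℝ → ℝ) (H : ConeConv a b c g)
    (ha : 0 < a) (hb : 0 < b) (hc : 0 < c) (h3 : a < b + c) (h1 : c < a + b)
    (h2 : b < a + c) :
    4 * (b + c) ^ 2 * g 0 0 0 ≤ (b + c) * (b + c - a) * (g (-1) 1 1 + g 1 (-1) 1)
      + ((b + c) ^ 2 + a ^ 2) * g 1 1 (-1)
      + ((b + c) ^ 2 - a ^ 2) * g (-1) (-1) (-1)
      + a * (a + b + c) * g (-1) (-1) 1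
      + a * (b + c - a) * g 1 1 1 := by
  have h := mul_le_mul_of_nonneg_left (type_three a b c g H ha hb hc h3 h1 h2)
    (sq_nonneg (b + c))
  have hz : a / (b + c) * (b + c) = a := by field_simp
  generalize a / (b + c) = z at *
  subst hz
  linarith

theorem combine (a b c : ℝ) (g : ℝ → ℝ → ℝ → ℝ) (H : ConeConv a b c g)
    (ha : 0 < a) (hb : 0 < b) (hc : 0 < c) (h3 : a < b + c) (h1 : c < a + b)
    (h2 : b < a + c) :
    4 * ((a + b + c) * (a * b + a * c + b * c) - 5 * (a * b * c)) * g 0 0 0 ≤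
      a * b * c * (g 1 1 1 + g 1 (-1) (-1) + g (-1) 1 (-1) + g (-1) (-1) 1)
      + ((a + b + c) * (a * b + a * c + b * c) - 6 * (a * b * c)) *
        (g (-1) (-1) (-1) + g 1 1 (-1) + g 1 (-1) 1 + g (-1) 1 1) := by
  have t3 := mul_le_mul_of_nonneg_left (type_three_poly a b c g H ha hb hc h3 h1 h2)
    (mul_pos hb hc).le
  have t2 := mul_le_mul_of_nonneg_left (type_three_poly b a c (fun x y z => g x z y) (by
      intro x y z x1 y1 z1 x2 y2 z2 m1 m2 p1 p2 q e1 e2 e3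
      exact H x z y x1 z1 y1 x2 z2 y2 m1 m2 p1 p2 (by linarith) e1 e3 e2)
      hb ha hc h2 (by linarith) h3) (mul_pos ha hc).le
  have t1 := mul_le_mul_of_nonneg_left (type_three_poly c a b (fun x y z => g z x y) (by
      intro x y z x1 y1 z1 x2 y2 z2 m1 m2 p1 p2 q e1 e2 e3
      exact H z x y z1 x1 y1 z2 x2 y2 m1 m2 p1 p2 (by linarith) e3 e1 e2)
      hc ha hb h1 (by linarith) (by linarith)) (mul_pos ha hb).le
  have hS : 0 < a + b + c := by positivity
  refine le_of_mul_le_mul_left ?_ hS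
  linarith

/-- Case 1 of the main theorem. Under the triangle inequalities on
`a = det(C₁+C₂)`, `b = det(C₁+C₃)`, `c = det(C₂+C₃)` there is a symmetric laminate with
ratio `β/α = (a+b+c)(1/a+1/b+1/c) − 6 ≥ 3`. -/
theorem symmetric_laminate_case_triangle
    (C₁ C₂ C₃ : Matrix (Fin 2) (Fin 2) ℝ)
    (hC₁ : C₁.rank = 1) (hC₂ : C₂.rank = 1) (hC₃ : C₃.rank = 1)
    (ha : 0 < (C₁ + C₂).det) (hb : 0 < (C₁ + C₃).det) (hc : 0 < (C₂ + C₃).det)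
    (htri₁ : (C₂ + C₃).det < (C₁ + C₂).det + (C₁ + C₃).det)
    (htri₂ : (C₁ + C₃).det < (C₁ + C₂).det + (C₂ + C₃).det)
    (htri₃ : (C₁ + C₂).det < (C₁ + C₃).det + (C₂ + C₃).det) :
    ∃ α β : ℝ, 0 < α ∧ 0 < β ∧ α + β = 1/4 ∧
      β / α = ((C₁ + C₂).det + (C₁ + C₃).det + (C₂ + C₃).det)
                * (1 / (C₁ + C₂).det + 1 / (C₁ + C₃).det + 1 / (C₂ + C₃).det) - 6 ∧
      3 ≤ β / α ∧
      ∀ f : Matrix (Fin 2) (Fin 2) ℝ → ℝ,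
        (∀ A B : Matrix (Fin 2) (Fin 2) ℝ, B.rank ≤ 1 →
          ConvexOn ℝ Set.univ (fun t : ℝ => f (A + t • B))) →
        f 0 ≤ α * (f (C₁ + C₂ + C₃) + f (C₁ - C₂ - C₃) + f (-C₁ + C₂ - C₃)
                     + f (-C₁ - C₂ + C₃))
            + β * (f (-C₁ - C₂ - C₃) + f (C₁ + C₂ - C₃) + f (C₁ - C₂ + C₃)
                     + f (-C₁ + C₂ + C₃)) := by
  have d₁ := det_zero_of_rank C₁ hC₁
  have d₂ := det_zero_of_rank C₂ hC₂
  have d₃ := det_zero_of_rank C₃ hC₃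
  have key := fun f hf => combine _ _ _ _
    (cone_of_rank C₁ C₂ C₃ d₁ d₂ d₃ rank_of_det_zero f hf) ha hb hc htri₃ htri₁ htri₂
  generalize (C₁ + C₂).det = a at *
  generalize (C₁ + C₃).det = b at *
  generalize (C₂ + C₃).det = c at *
  have hp : 0 < a * b * c := by positivity
  obtain ⟨R, hR⟩ : ∃ R : ℝ, R = (a + b + c) * (a * b + a * c + b * c) - 6 * (a * b * c) :=
    ⟨_, rfl⟩
  have hR3 : 3 * (a * b * c) ≤ R := by
    rw [hR]
    nlinarith [mul_nonneg ha.le (sq_nonneg (b - c)), mul_nonneg hb.le (sq_nonneg (a - c)),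
      mul_nonneg hc.le (sq_nonneg (a - b))]
  have hR0 : 0 < R := by linarith
  have hD : 0 < R + a * b * c := by linarith
  have hquo : R / (4 * (R + a * b * c)) / (a * b * c / (4 * (R + a * b * c)))
      = R / (a * b * c) := by
    field_simp
  refine ⟨a * b * c / (4 * (R + a * b * c)), R / (4 * (R + a * b * c)), by positivity,
    by positivity, ?_, ?_, ?_, ?_⟩
  · field_simp
    ring
  · rw [hquo, hR]
    field_simp
    ring
  · rw [hquo, le_div_iff₀ hp]
    exact hR3
  · intro f hf
    have k := key f hf
    simp only [one_smul, neg_smul, zero_smul, add_zero, ← sub_eq_add_neg] at k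
    generalize f (C₁ + C₂ + C₃) + f (C₁ - C₂ - C₃) + f (-C₁ + C₂ - C₃)
                     + f (-C₁ - C₂ + C₃) = P at *
    generalize f (-C₁ - C₂ - C₃) + f (C₁ + C₂ - C₃) + f (C₁ - C₂ + C₃)
                     + f (-C₁ + C₂ + C₃) = Q at *
    rw [div_mul_eq_mul_div, div_mul_eq_mul_div, ← add_div, le_div_iff₀ (by positivity), hR]
    linarith
end
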